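/- arXiv:2506.01722 — 2 statements merged into one kernel-verified Lean document; each statement's English description precedes it below -/
import Mathlib

section
/- (Cost of truncation for the OMD clipping.) Let β > 0, let ℓ_1, …, ℓ_T ∈ ℝ^K be arbitrary loss vectors and p_1, …, p_T ∈ P arbitrary predictions with v̄_1 > 0. With η_{t,i} and ℓ̃_t as defined from these quantities: (a) Σ_{t=1}^T Σ_{i=1}^K p_t(i)·|(−r_t(i)) − ℓ̃_t(i)| ≤ 2β·√(Σ_{t=1}^T v̄_t), and (b) for every j ∈ [K], Σ_{t=1}^T |(−r_t(j)) − ℓ̃_t(j)| ≤ 2β·√(Σ_{t=1}^T v_t(j)). -/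
open Finset

noncomputable section

/-- The probability simplex over `K` experts. -/
def probSimplex (K : ℕ) : Set (Fin K → ℝ) :=
  {q | (∀ i, 0 ≤ q i) ∧ ∑ i, q i = 1}

/-- The probability simplex truncated by `α / K`. -/
def probSimplexTrunc (K : ℕ) (α : ℝ) : Set (Fin K → ℝ) :=
  {q ∈ probSimplex K | ∀ i, α / K ≤ q i}

/-- Instantaneous regret `r_t(i) = ⟨p_t, ℓ_t⟩ - ℓ_t(i)`. -/
def instReg {K : ℕ} (p ℓ : ℕ → Fin K → ℝ) (t : ℕ) (i : Fin K) : ℝ :=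
  (∑ j, p t j * ℓ t j) - ℓ t i

/-- `v_t(i) = r_t(i)²`. -/
def vSq {K : ℕ} (p ℓ : ℕ → Fin K → ℝ) (t : ℕ) (i : Fin K) : ℝ :=
  (instReg p ℓ t i) ^ 2

/-- `v̄_t = Σ_i p_t(i) v_t(i)`. -/
def vBar {K : ℕ} (p ℓ : ℕ → Fin K → ℝ) (t : ℕ) : ℝ :=
  ∑ i, p t i * vSq p ℓ t i

/-- OMD learning rate `η_{t,i} = β / √(max{Σ_{s≤t} v̄_s, Σ_{s≤t} v_s(i)})`. -/
def lrOMD {K : ℕ} (β : ℝ) (p ℓ : ℕ → Fin K → ℝ) (t : ℕ) (i : Fin K) : ℝ :=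
  β / Real.sqrt (max (∑ s ∈ Finset.Icc 1 t, vBar p ℓ s)
                     (∑ s ∈ Finset.Icc 1 t, vSq p ℓ s i))

/-- OMD truncated loss `ℓ̃_t(i) = -r_t(i)·𝟙(|r_t(i)| ≤ 1/η_{t,i})`. -/
def truncOMD {K : ℕ} (β : ℝ) (p ℓ : ℕ → Fin K → ℝ) (t : ℕ) (i : Fin K) : ℝ :=
  if |instReg p ℓ t i| ≤ 1 / lrOMD β p ℓ t i then -instReg p ℓ t i else 0

/-- Bregman divergence `D(x ‖ y) = Σ_i (1/η_i)(x_i log(x_i/y_i) - x_i + y_i)`. -/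
def bregD {K : ℕ} (η : Fin K → ℝ) (x y : Fin K → ℝ) : ℝ :=
  ∑ i, (1 / η i) * (x i * Real.log (x i / y i) - x i + y i)

/-- The self-normalised sum `Σ_t f_t / √(Σ_{s ≤ t} f_s)` is at most `2 √(Σ_t f_t)`. -/
theorem sum_div_sqrt_sum_le (f : ℕ → ℝ) (T : ℕ) (hf : ∀ t ∈ Finset.Icc 1 T, 0 ≤ f t) :
    ∑ t ∈ Finset.Icc 1 T, f t / Real.sqrt (∑ s ∈ Finset.Icc 1 t, f s)
      ≤ 2 * Real.sqrt (∑ t ∈ Finset.Icc 1 T, f t) := by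
  induction T with
  | zero => simp
  | succ n ih =>
    have hf' : ∀ t ∈ Finset.Icc 1 n, 0 ≤ f t := fun t ht =>
      hf t (Finset.Icc_subset_Icc_right n.le_succ ht)
    have hn : 0 ≤ f (n + 1) := hf _ (by simp)
    have hS : 0 ≤ ∑ t ∈ Finset.Icc 1 n, f t := Finset.sum_nonneg hf'
    specialize ih hf'
    rw [Finset.sum_Icc_succ_top (by omega), Finset.sum_Icc_succ_top (by omega)]
    set S := ∑ t ∈ Finset.Icc 1 n, f t
    have hle : Real.sqrt S ≤ Real.sqrt (S + f (n + 1)) := Real.sqrt_le_sqrt (by linarith)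
    have h₁ := Real.sq_sqrt hS
    have h₂ := Real.sq_sqrt (add_nonneg hS hn)
    have key : f (n + 1) / Real.sqrt (S + f (n + 1))
        ≤ 2 * (Real.sqrt (S + f (n + 1)) - Real.sqrt S) :=
      div_le_of_le_mul₀ (Real.sqrt_nonneg _) (by linarith)
        (by nlinarith [sq_nonneg (Real.sqrt (S + f (n + 1)) - Real.sqrt S)])
    linarith

/-- The truncation error of a single loss, in terms of any lower bound `S` on the quantity
under the square root in the learning rate. -/
theorem abs_neg_instReg_sub_truncOMD_le {K : ℕ} {β : ℝ} (hβ : 0 < β) (p ℓ : ℕ → Fin K → ℝ)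
    (t : ℕ) (i : Fin K) {S : ℝ}
    (hS : S ≤ max (∑ s ∈ Finset.Icc 1 t, vBar p ℓ s) (∑ s ∈ Finset.Icc 1 t, vSq p ℓ s i))
    (hpos : instReg p ℓ t i ≠ 0 → 0 < S) :
    |(-instReg p ℓ t i) - truncOMD β p ℓ t i| ≤ β * (vSq p ℓ t i / Real.sqrt S) := by
  have hv : 0 ≤ vSq p ℓ t i := sq_nonneg _
  unfold truncOMD
  split_ifs with h
  · rw [sub_self, abs_zero]
    positivity
  · rw [lrOMD, one_div_div, not_le, div_lt_iff₀ hβ] at h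
    have hr : 0 < |instReg p ℓ t i| := by
      by_contra! hr
      nlinarith [Real.sqrt_nonneg (max (∑ s ∈ Finset.Icc 1 t, vBar p ℓ s)
        (∑ s ∈ Finset.Icc 1 t, vSq p ℓ s i))]
    have hlt : Real.sqrt S < |instReg p ℓ t i| * β := (Real.sqrt_le_sqrt hS).trans_lt h
    rw [sub_zero, abs_neg, ← mul_div_assoc,
      le_div_iff₀ (Real.sqrt_pos.2 (hpos (abs_pos.1 hr))), vSq, ← sq_abs]
    nlinarith

theorem stmt_16 (K T : ℕ) (hK : 2 ≤ K) (hT : 2 ≤ T) (β : ℝ) (hβ : 0 < β)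
    (ℓ p : ℕ → Fin K → ℝ)
    (hp : ∀ t ∈ Finset.Icc 1 T, p t ∈ probSimplex K)
    (hv1 : 0 < vBar p ℓ 1) :
    (∑ t ∈ Finset.Icc 1 T, ∑ i, p t i * |(-instReg p ℓ t i) - truncOMD β p ℓ t i|
        ≤ 2 * β * Real.sqrt (∑ t ∈ Finset.Icc 1 T, vBar p ℓ t)) ∧
    (∀ j : Fin K,
      ∑ t ∈ Finset.Icc 1 T, |(-instReg p ℓ t j) - truncOMD β p ℓ t j|
        ≤ 2 * β * Real.sqrt (∑ t ∈ Finset.Icc 1 T, vSq p ℓ t j)) := by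
  have hbar : ∀ t ∈ Finset.Icc 1 T, 0 ≤ vBar p ℓ t := fun t ht =>
    Finset.sum_nonneg fun i _ => mul_nonneg ((hp t ht).1 i) (sq_nonneg _)
  constructor
  · have hpos : ∀ t ∈ Finset.Icc 1 T, 0 < ∑ s ∈ Finset.Icc 1 t, vBar p ℓ s := by
      intro t ht
      obtain ⟨h1, hT'⟩ := Finset.mem_Icc.1 ht
      exact hv1.trans_le (Finset.single_le_sum
        (fun s hs => hbar s (Finset.Icc_subset_Icc_right hT' hs))
        (Finset.mem_Icc.2 ⟨le_rfl, h1⟩))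
    calc ∑ t ∈ Finset.Icc 1 T, ∑ i, p t i * |(-instReg p ℓ t i) - truncOMD β p ℓ t i|
        ≤ ∑ t ∈ Finset.Icc 1 T,
            β * (vBar p ℓ t / Real.sqrt (∑ s ∈ Finset.Icc 1 t, vBar p ℓ s)) := by
          refine Finset.sum_le_sum fun t ht => ?_
          rw [vBar, Finset.sum_div, Finset.mul_sum]
          refine Finset.sum_le_sum fun i _ => ?_
          rw [mul_div_assoc, mul_left_comm]
          exact mul_le_mul_of_nonneg_left (abs_neg_instReg_sub_truncOMD_le hβ p ℓ t i
            (le_max_left _ _) fun _ => hpos t ht) ((hp t ht).1 i)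
      _ ≤ 2 * β * Real.sqrt (∑ t ∈ Finset.Icc 1 T, vBar p ℓ t) := by
          rw [← Finset.mul_sum, mul_comm 2 β, mul_assoc]
          exact mul_le_mul_of_nonneg_left (sum_div_sqrt_sum_le _ T hbar) hβ.le
  · intro j
    calc ∑ t ∈ Finset.Icc 1 T, |(-instReg p ℓ t j) - truncOMD β p ℓ t j|
        ≤ ∑ t ∈ Finset.Icc 1 T,
            β * (vSq p ℓ t j / Real.sqrt (∑ s ∈ Finset.Icc 1 t, vSq p ℓ s j)) := by
          refine Finset.sum_le_sum fun t ht => abs_neg_instReg_sub_truncOMD_le hβ p ℓ t j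
            (le_max_right _ _) fun hr => ?_
          exact (sq_pos_of_ne_zero hr).trans_le (Finset.single_le_sum
            (f := fun s => vSq p ℓ s j) (fun s _ => sq_nonneg _)
            (Finset.mem_Icc.2 ⟨(Finset.mem_Icc.1 ht).1, le_rfl⟩))
      _ ≤ 2 * β * Real.sqrt (∑ t ∈ Finset.Icc 1 T, vSq p ℓ t j) := by
          rw [← Finset.mul_sum, mul_comm 2 β, mul_assoc]
          exact mul_le_mul_of_nonneg_left
            (sum_div_sqrt_sum_le (fun t => vSq p ℓ t j) T fun t _ => sq_nonneg _) hβ.le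
end
end

section
/- (Cost of truncation for the FTRL clipping.) Let β > 0, let ℓ_1, …, ℓ_T ∈ ℝ^K be arbitrary loss vectors and p_1, …, p_T ∈ P arbitrary predictions with v̄_1 > 0. With b_t(i), η_{t,i}, and ℓ̃_t as defined from these quantities: (a) Σ_{t=1}^T Σ_{i=1}^K p_t(i)·|(−r_t(i)) − ℓ̃_t(i)| ≤ 2·(β + 2/β)·√(Σ_{t=1}^T v̄_t), and (b) for every j ∈ [K], Σ_{t=1}^T |(−r_t(j)) − ℓ̃_t(j)| ≤ (1/β)·√(Σ_{t=1}^T v̄_t) + (2β + 1/β)·√(Σ_{t=1}^T v_t(j)). -/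
open Finset

noncomputable section

/-- `b_t(i) = √(max{Σ_{s≤t} v̄_s, Σ_{s≤t} v_s(i)})`; note `b_0(i) = 0`. -/
def bFTRL {K : ℕ} (p ℓ : ℕ → Fin K → ℝ) (t : ℕ) (i : Fin K) : ℝ :=
  Real.sqrt (max (∑ s ∈ Finset.Icc 1 t, vBar p ℓ s)
                 (∑ s ∈ Finset.Icc 1 t, vSq p ℓ s i))

/-- FTRL learning rate `η_{t,i} = β / b_t(i)`. -/
def lrFTRL {K : ℕ} (β : ℝ) (p ℓ : ℕ → Fin K → ℝ) (t : ℕ) (i : Fin K) : ℝ :=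
  β / bFTRL p ℓ t i

/-- FTRL truncated loss
`ℓ̃_t(i) = -r_t(i)·(b_{t-1}(i)/b_t(i))·𝟙(|r_t(i)| ≤ 1/η_{t,i})`. -/
def truncFTRL {K : ℕ} (β : ℝ) (p ℓ : ℕ → Fin K → ℝ) (t : ℕ) (i : Fin K) : ℝ :=
  if |instReg p ℓ t i| ≤ 1 / lrFTRL β p ℓ t i then
    -instReg p ℓ t i * (bFTRL p ℓ (t - 1) i / bFTRL p ℓ t i)
  else 0

theorem div_le_two_mul_sqrt_sub {S x b : ℝ} (hS : 0 ≤ S) (hx : 0 ≤ x) (hb : 0 < b)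
    (h : √(S + x) ≤ b) : x / b ≤ 2 * (√(S + x) - √S) := by
  have hle : √S ≤ √(S + x) := Real.sqrt_le_sqrt (by linarith)
  have h1 := Real.sq_sqrt hS
  have h2 := Real.sq_sqrt (add_nonneg hS hx)
  rw [div_le_iff₀ hb]
  nlinarith [mul_nonneg (sub_nonneg.2 hle) (by linarith : 0 ≤ 2 * b - (√(S + x) + √S))]

theorem sum_div_le_two_mul_sqrt (x b : ℕ → ℝ) (n : ℕ) (hx : ∀ t ∈ Icc 1 n, 0 ≤ x t)
    (hb : ∀ t ∈ Icc 1 n, 0 < b t) (h : ∀ t ∈ Icc 1 n, √(∑ s ∈ Icc 1 t, x s) ≤ b t) :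
    ∑ t ∈ Icc 1 n, x t / b t ≤ 2 * √(∑ t ∈ Icc 1 n, x t) := by
  induction n with
  | zero => simp
  | succ n ih =>
    have hsub : ∀ t ∈ Icc 1 n, t ∈ Icc 1 (n + 1) := fun t ht => by
      simp only [mem_Icc] at ht ⊢; omega
    have hmem : n + 1 ∈ Icc 1 (n + 1) := by simp
    have ih' := ih (fun t ht => hx t (hsub t ht)) (fun t ht => hb t (hsub t ht))
      (fun t ht => h t (hsub t ht))
    have hlast := h _ hmem
    rw [sum_Icc_succ_top (by omega)] at hlast
    have := div_le_two_mul_sqrt_sub (sum_nonneg fun t ht => hx t (hsub t ht))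
      (hx _ hmem) (hb _ hmem) hlast
    rw [sum_Icc_succ_top (by omega), sum_Icc_succ_top (by omega)]
    linarith

theorem sum_Icc_sub_pred (b : ℕ → ℝ) (n : ℕ) :
    ∑ t ∈ Icc 1 n, (b t - b (t - 1)) = b n - b 0 := by
  induction n with
  | zero => simp
  | succ n ih =>
    rw [sum_Icc_succ_top (by omega), ih]
    simp

section FTRL

variable {K : ℕ} {p ℓ : ℕ → Fin K → ℝ}

theorem vSq_nonneg (t : ℕ) (i : Fin K) : 0 ≤ vSq p ℓ t i := sq_nonneg _

theorem vBar_nonneg {t : ℕ} (h : p t ∈ probSimplex K) : 0 ≤ vBar p ℓ t :=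
  sum_nonneg fun i _ => mul_nonneg (h.1 i) (vSq_nonneg t i)

theorem sqrt_sum_vBar_le_bFTRL (t : ℕ) (i : Fin K) :
    √(∑ s ∈ Icc 1 t, vBar p ℓ s) ≤ bFTRL p ℓ t i :=
  Real.sqrt_le_sqrt (le_max_left _ _)

theorem sqrt_sum_vSq_le_bFTRL (t : ℕ) (i : Fin K) :
    √(∑ s ∈ Icc 1 t, vSq p ℓ s i) ≤ bFTRL p ℓ t i :=
  Real.sqrt_le_sqrt (le_max_right _ _)

theorem bFTRL_le_sqrt_add_sqrt (t : ℕ) (i : Fin K) :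
    bFTRL p ℓ t i ≤ √(∑ s ∈ Icc 1 t, vBar p ℓ s) + √(∑ s ∈ Icc 1 t, vSq p ℓ s i) := by
  rw [bFTRL, Real.sqrt_monotone.map_max]
  exact max_le_add_of_nonneg (Real.sqrt_nonneg _) (Real.sqrt_nonneg _)

theorem bFTRL_sq (t : ℕ) (i : Fin K) :
    bFTRL p ℓ t i ^ 2 = max (∑ s ∈ Icc 1 t, vBar p ℓ s) (∑ s ∈ Icc 1 t, vSq p ℓ s i) :=
  Real.sq_sqrt (le_max_of_le_right (sum_nonneg fun s _ => vSq_nonneg s i))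

theorem bFTRL_pred_le {t : ℕ} (ht : 1 ≤ t) (h : p t ∈ probSimplex K) (i : Fin K) :
    bFTRL p ℓ (t - 1) i ≤ bFTRL p ℓ t i := by
  obtain ⟨n, rfl⟩ := Nat.exists_eq_add_of_le' ht
  rw [Nat.add_sub_cancel]
  refine Real.sqrt_le_sqrt (max_le_max ?_ ?_) <;> rw [sum_Icc_succ_top (by omega)]
  · linarith [vBar_nonneg (ℓ := ℓ) h]
  · linarith [vSq_nonneg (p := p) (ℓ := ℓ) (n + 1) i]

theorem bFTRL_sq_sub_pred_sq_le {t : ℕ} (ht : 1 ≤ t) (h : p t ∈ probSimplex K) (i : Fin K) :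
    bFTRL p ℓ t i ^ 2 - bFTRL p ℓ (t - 1) i ^ 2 ≤ vBar p ℓ t + vSq p ℓ t i := by
  obtain ⟨n, rfl⟩ := Nat.exists_eq_add_of_le' ht
  rw [Nat.add_sub_cancel, bFTRL_sq, bFTRL_sq, sum_Icc_succ_top (by omega),
    sum_Icc_succ_top (by omega), sub_le_iff_le_add]
  have h1 := vBar_nonneg (ℓ := ℓ) h
  have h2 := vSq_nonneg (p := p) (ℓ := ℓ) (n + 1) i
  refine max_le ?_ ?_
  · linarith [le_max_left (∑ s ∈ Icc 1 n, vBar p ℓ s) (∑ s ∈ Icc 1 n, vSq p ℓ s i)]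
  · linarith [le_max_right (∑ s ∈ Icc 1 n, vBar p ℓ s) (∑ s ∈ Icc 1 n, vSq p ℓ s i)]

/-- Either the loss is kept and only rescaled, or it is large and its square pays for it. -/
theorem abs_sub_truncFTRL_le {β : ℝ} (hβ : 0 < β) {t : ℕ} (ht : 1 ≤ t)
    (h : p t ∈ probSimplex K) (i : Fin K) (hb : 0 < bFTRL p ℓ t i) :
    |(-instReg p ℓ t i) - truncFTRL β p ℓ t i|
      ≤ (bFTRL p ℓ t i - bFTRL p ℓ (t - 1) i) / β + β * (vSq p ℓ t i / bFTRL p ℓ t i) := by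
  have hmono := bFTRL_pred_le (ℓ := ℓ) ht h i
  unfold truncFTRL lrFTRL vSq
  set b := bFTRL p ℓ t i
  set a := bFTRL p ℓ (t - 1) i
  set r := instReg p ℓ t i
  have hinc : 0 ≤ (b - a) / β := div_nonneg (sub_nonneg.2 hmono) hβ.le
  have hsq : 0 ≤ β * (r ^ 2 / b) := by positivity
  rw [one_div_div]
  split_ifs with hr
  · have heq : -r - -r * (a / b) = -(r * ((b - a) / b)) := by field_simp; ring
    have hfrac : 0 ≤ (b - a) / b := div_nonneg (sub_nonneg.2 hmono) hb.le
    rw [heq, abs_neg, abs_mul, abs_of_nonneg hfrac]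
    calc |r| * ((b - a) / b) ≤ b / β * ((b - a) / b) := by gcongr
      _ = (b - a) / β := by field_simp
      _ ≤ _ := by linarith
  · rw [not_le, div_lt_iff₀ hβ] at hr
    rw [sub_zero, abs_neg]
    have : |r| ≤ β * (r ^ 2 / b) := by
      rw [← mul_div_assoc, le_div_iff₀ hb, ← sq_abs]
      nlinarith [abs_nonneg r]
    linarith

theorem bFTRL_sub_pred_le {t : ℕ} (ht : 1 ≤ t) (h : p t ∈ probSimplex K) (i : Fin K)
    (hb : 0 < bFTRL p ℓ t i) :
    bFTRL p ℓ t i - bFTRL p ℓ (t - 1) i ≤ (vBar p ℓ t + vSq p ℓ t i) / bFTRL p ℓ t i := by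
  have hmono := bFTRL_pred_le (ℓ := ℓ) ht h i
  have hnn : 0 ≤ bFTRL p ℓ (t - 1) i := Real.sqrt_nonneg _
  rw [le_div_iff₀ hb]
  nlinarith [bFTRL_sq_sub_pred_sq_le (ℓ := ℓ) ht h i, mul_nonneg (sub_nonneg.2 hmono) hnn]

theorem sum_mul_abs_sub_truncFTRL_le {β : ℝ} (hβ : 0 < β) {t : ℕ} (ht : 1 ≤ t)
    (h : p t ∈ probSimplex K) (hV : 0 < ∑ s ∈ Icc 1 t, vBar p ℓ s) :
    ∑ i, p t i * |(-instReg p ℓ t i) - truncFTRL β p ℓ t i|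
      ≤ (β + 2 / β) * (vBar p ℓ t / √(∑ s ∈ Icc 1 t, vBar p ℓ s)) := by
  set c := √(∑ s ∈ Icc 1 t, vBar p ℓ s) with hc
  have hc0 : 0 < c := Real.sqrt_pos.2 hV
  have hvb := vBar_nonneg (ℓ := ℓ) h
  calc ∑ i, p t i * |(-instReg p ℓ t i) - truncFTRL β p ℓ t i|
      ≤ ∑ i, p t i * ((vBar p ℓ t + vSq p ℓ t i) / c / β + β * (vSq p ℓ t i / c)) := by
        refine sum_le_sum fun i _ => mul_le_mul_of_nonneg_left ?_ (h.1 i)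
        have hcb : c ≤ bFTRL p ℓ t i := sqrt_sum_vBar_le_bFTRL t i
        have hb := hc0.trans_le hcb
        have hv := vSq_nonneg (p := p) (ℓ := ℓ) t i
        refine (abs_sub_truncFTRL_le hβ ht h i hb).trans ?_
        have := (bFTRL_sub_pred_le ht h i hb).trans
          (div_le_div_of_nonneg_left (add_nonneg hvb hv) hc0 hcb)
        gcongr
    _ = ∑ i, (p t i * (vBar p ℓ t / c / β) + (p t i * vSq p ℓ t i) * (1 / c / β + β / c)) :=
        sum_congr rfl fun i _ => by ring
    _ = vBar p ℓ t / c / β + vBar p ℓ t * (1 / c / β + β / c) := by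
        rw [sum_add_distrib, ← sum_mul, ← sum_mul, h.2, one_mul, vBar]
    _ = _ := by ring

end FTRL

theorem stmt_18 (K T : ℕ) (hK : 2 ≤ K) (hT : 2 ≤ T) (β : ℝ) (hβ : 0 < β)
    (ℓ p : ℕ → Fin K → ℝ)
    (hp : ∀ t ∈ Finset.Icc 1 T, p t ∈ probSimplex K)
    (hv1 : 0 < vBar p ℓ 1) :
    (∑ t ∈ Finset.Icc 1 T, ∑ i, p t i * |(-instReg p ℓ t i) - truncFTRL β p ℓ t i|
        ≤ 2 * (β + 2 / β) * Real.sqrt (∑ t ∈ Finset.Icc 1 T, vBar p ℓ t)) ∧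
    (∀ j : Fin K,
      ∑ t ∈ Finset.Icc 1 T, |(-instReg p ℓ t j) - truncFTRL β p ℓ t j|
        ≤ (1 / β) * Real.sqrt (∑ t ∈ Finset.Icc 1 T, vBar p ℓ t)
          + (2 * β + 1 / β) * Real.sqrt (∑ t ∈ Finset.Icc 1 T, vSq p ℓ t j)) := by
  have hV : ∀ t ∈ Icc 1 T, 0 < ∑ s ∈ Icc 1 t, vBar p ℓ s := fun t ht => by
    rw [mem_Icc] at ht
    refine hv1.trans_le (single_le_sum (f := vBar p ℓ) (fun s hs => vBar_nonneg (hp s ?_)) ?_) <;>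
      simp only [mem_Icc] at * <;> omega
  refine ⟨?_, fun j => ?_⟩
  · have hsum := sum_div_le_two_mul_sqrt (vBar p ℓ) (fun t => √(∑ s ∈ Icc 1 t, vBar p ℓ s)) T
      (fun t ht => vBar_nonneg (hp t ht)) (fun t ht => Real.sqrt_pos.2 (hV t ht))
      (fun t _ => le_rfl)
    calc _ ≤ ∑ t ∈ Icc 1 T, (β + 2 / β) * (vBar p ℓ t / √(∑ s ∈ Icc 1 t, vBar p ℓ s)) :=
          sum_le_sum fun t ht =>
            sum_mul_abs_sub_truncFTRL_le hβ (mem_Icc.1 ht).1 (hp t ht) (hV t ht)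
      _ ≤ (β + 2 / β) * (2 * √(∑ t ∈ Icc 1 T, vBar p ℓ t)) := by
          rw [← mul_sum]
          gcongr
      _ = _ := by ring
  · have hb : ∀ t ∈ Icc 1 T, 0 < bFTRL p ℓ t j := fun t ht =>
      (Real.sqrt_pos.2 (hV t ht)).trans_le (sqrt_sum_vBar_le_bFTRL t j)
    have hsum := sum_div_le_two_mul_sqrt (fun t => vSq p ℓ t j) (fun t => bFTRL p ℓ t j) T
      (fun t _ => vSq_nonneg t j) hb (fun t _ => sqrt_sum_vSq_le_bFTRL t j)
    have hb0 : bFTRL p ℓ 0 j = 0 := by simp [bFTRL]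
    calc _ ≤ ∑ t ∈ Icc 1 T, ((bFTRL p ℓ t j - bFTRL p ℓ (t - 1) j) / β
            + β * (vSq p ℓ t j / bFTRL p ℓ t j)) :=
          sum_le_sum fun t ht => abs_sub_truncFTRL_le hβ (mem_Icc.1 ht).1 (hp t ht) j (hb t ht)
      _ = bFTRL p ℓ T j / β + β * ∑ t ∈ Icc 1 T, vSq p ℓ t j / bFTRL p ℓ t j := by
          rw [sum_add_distrib, ← sum_div, ← mul_sum, sum_Icc_sub_pred (fun t => bFTRL p ℓ t j),
            hb0, sub_zero]
      _ ≤ (√(∑ t ∈ Icc 1 T, vBar p ℓ t) + √(∑ t ∈ Icc 1 T, vSq p ℓ t j)) / β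
            + β * (2 * √(∑ t ∈ Icc 1 T, vSq p ℓ t j)) := by
          gcongr
          exact bFTRL_le_sqrt_add_sqrt T j
      _ = _ := by ring
end
end
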